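/- Let σ(x) = 1/(1 + e^{-x}) be the logistic sigmoid, u an N×M real matrix, p ∈ (0,1)^N and q ∈ (0,1)^M with ∑_i p_i = 1, ∑_j q_j = 1, and λ*, μ* ∈ ℝ with ∑_j u_{ij} q_j + λ* = 0 for all i and ∑_i u_{ij} p_i + μ* = 0 for all j. Define the vector field Y on ℝ^N × ℝ^M × ℝ × ℝ by Y(θ, φ, λ, μ) = ( (-σ'(θ_i)(∑_j u_{ij} σ(φ_j) + λ))_{i=1..N}, (σ'(φ_j)(∑_i u_{ij} σ(θ_i) + μ))_{j=1..M}, ∑_i σ(θ_i) - 1, -(∑_j σ(φ_j) - 1) ). Suppose Φ : (ℝ^{N+M+2}) × ℝ → ℝ^{N+M+2} is a global flow of Y, i.e., Φ(x, 0) = x and (d/dt) Φ(x, t) = Y(Φ(x, t)) for all x and t. Then Lebesgue-almost every point x ∈ ℝ^{N+M+2} is recurrent under Φ: the set of points x for which there exists an open neighborhood U of x and a time T such that Φ(x, t) ∉ U for all t > T has Lebesgue measure zero. -/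

import Mathlib

open MeasureTheory Filter Topology Set
open scoped NNReal ENNReal

/-- A pointwise limit of measure-preserving maps does not increase measure. -/
theorem map_le_of_tendsto_measurePreserving {X : Type*} [TopologicalSpace X]
    [TopologicalSpace.PseudoMetrizableSpace X] [MeasurableSpace X] [BorelSpace X]
    {μ : Measure X} [μ.OuterRegular] {S : ℕ → X → X} {f : X → X}
    (hS : ∀ n, MeasurePreserving (S n) μ μ)
    (hlim : ∀ x, Tendsto (fun n => S n x) atTop (𝓝 (f x))) :
    μ.map f ≤ μ := by
  have hf : Measurable f :=
    measurable_of_tendsto_metrizable (fun n => (hS n).measurable) (tendsto_pi_nhds.2 hlim)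
  have hopen : ∀ U : Set X, IsOpen U → μ (f ⁻¹' U) ≤ μ U := by
    intro U hU
    have hpt : ∀ x, (f ⁻¹' U).indicator (1 : X → ℝ≥0∞) x
        ≤ liminf (fun n => (S n ⁻¹' U).indicator (1 : X → ℝ≥0∞) x) atTop := by
      intro x
      by_cases hx : f x ∈ U
      · refine (indicator_le_self' (fun _ _ => zero_le) x).trans ?_
        refine le_liminf_of_le (by isBoundedDefault) ?_
        filter_upwards [(hlim x).eventually_mem (hU.mem_nhds hx)] with n hn
        simp [indicator_of_mem (show x ∈ S n ⁻¹' U from hn)]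
      · simp [indicator_of_notMem (show x ∉ f ⁻¹' U from hx)]
    calc μ (f ⁻¹' U) = ∫⁻ x, (f ⁻¹' U).indicator 1 x ∂μ :=
          (lintegral_indicator_one (hf hU.measurableSet)).symm
      _ ≤ ∫⁻ x, liminf (fun n => (S n ⁻¹' U).indicator (1 : X → ℝ≥0∞) x) atTop ∂μ :=
          lintegral_mono hpt
      _ ≤ liminf (fun n => ∫⁻ x, (S n ⁻¹' U).indicator (1 : X → ℝ≥0∞) x ∂μ) atTop :=
          lintegral_liminf_le fun n =>
            measurable_one.indicator ((hS n).measurable hU.measurableSet)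
      _ = μ U := by
          simp_rw [fun n => lintegral_indicator_one (μ := μ)
            ((hS n).measurable hU.measurableSet),
            fun n => (hS n).measure_preimage hU.measurableSet.nullMeasurableSet]
          simp
  refine Measure.le_iff.2 fun s hs => ?_
  rw [Measure.map_apply hf hs, s.measure_eq_iInf_isOpen μ]
  exact le_iInf₂ fun U hsU => le_iInf fun hU =>
    (measure_mono (preimage_mono hsU)).trans (hopen U hU)

/-- Topological Poincaré recurrence for a map which does not increase measure and which has an
invariant function with sublevel sets of finite measure. -/
theorem ae_frequently_iterate_mem_of_invariant {X : Type*} [TopologicalSpace X]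
    [SecondCountableTopology X] [MeasurableSpace X] [BorelSpace X] {μ : Measure X}
    {f : X → X} (hf : Measurable f) (hmap : μ.map f ≤ μ) {H : X → ℝ} (hH : Measurable H)
    (hinv : ∀ x, H (f x) = H x) (hfin : ∀ c : ℝ, μ {x | H x ≤ c} < ∞) :
    ∀ᵐ x ∂μ, ∀ s ∈ 𝓝 x, ∃ᶠ n in atTop, f^[n] x ∈ s := by
  have key : ∀ k : ℕ, ∀ᵐ x ∂μ, H x ≤ k → ∀ s ∈ 𝓝 x, ∃ᶠ n in atTop, f^[n] x ∈ s := by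
    intro k
    set K : Set X := {x | H x ≤ k}
    have hK : MeasurableSet K := measurableSet_le hH measurable_const
    have hfK : f ⁻¹' K = K := by ext x; simp [K, hinv]
    have : IsFiniteMeasure (μ.restrict K) := ⟨by simpa using hfin k⟩
    have hle : (μ.restrict K).map f ≤ μ.restrict K := by
      refine Measure.le_iff.2 fun s hs => ?_
      rw [Measure.map_apply hf hs, Measure.restrict_apply (hf hs), Measure.restrict_apply hs]
      calc μ (f ⁻¹' s ∩ K) = μ (f ⁻¹' (s ∩ K)) := by rw [preimage_inter, hfK]
        _ = μ.map f (s ∩ K) := (Measure.map_apply hf (hs.inter hK)).symm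
        _ ≤ μ (s ∩ K) := hmap _
    have hmp : MeasurePreserving f (μ.restrict K) (μ.restrict K) :=
      ⟨hf, Measure.eq_of_le_of_measure_univ_eq hle
        (by rw [Measure.map_apply hf MeasurableSet.univ, preimage_univ])⟩
    exact (ae_restrict_iff' hK).1 hmp.conservative.ae_frequently_mem_of_mem_nhds
  filter_upwards [ae_all_iff.2 key] with x hx
  obtain ⟨k, hk⟩ := exists_nat_ge (H x)
  exact hx k hk

theorem norm_add_smul_sub_le {A B : Type*} [NormedAddCommGroup A] [NormedSpace ℝ A]
    [NormedAddCommGroup B] {V : B → A} {L : ℝ≥0} (hV : LipschitzWith L V) {h : ℝ}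
    (hh : 0 ≤ h) (a b : A) (v w : B) :
    ‖(a + h • V v) - (b + h • V w)‖ ≤ ‖a - b‖ + h * (L * ‖v - w‖) := by
  calc ‖(a + h • V v) - (b + h • V w)‖ = ‖(a - b) + h • (V v - V w)‖ := by
        rw [smul_sub]; congr 1; abel
    _ ≤ ‖a - b‖ + h * ‖V v - V w‖ := by
        refine (norm_add_le _ _).trans_eq ?_
        rw [norm_smul, Real.norm_of_nonneg hh]
    _ ≤ _ := by gcongr; exact hV.norm_sub_le _ _

/-- Error of one Euler step when the derivative stays close to the chosen slope. -/
theorem norm_add_smul_sub_le_of_hasDerivAt {A : Type*} [NormedAddCommGroup A]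
    [NormedSpace ℝ A] {g g' : ℝ → A} {v : A} {t h C : ℝ} (hh : 0 ≤ h)
    (hg : ∀ s, HasDerivAt g (g' s) s) (hv : ∀ s ∈ Icc t (t + h), ‖g' s - v‖ ≤ C) :
    ‖g t + h • v - g (t + h)‖ ≤ C * h := by
  have := (convex_Icc t (t + h)).norm_image_sub_le_of_norm_hasDerivWithin_le
    (f := fun s => g s - s • v) (f' := fun s => g' s - v)
    (fun s _ => ((hg s).sub (by simpa using (hasDerivAt_id s).smul_const v)).hasDerivWithinAt)
    hv ⟨le_rfl, by linarith⟩ ⟨by linarith, le_rfl⟩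
  rw [add_sub_cancel_left, Real.norm_of_nonneg hh] at this
  refine (le_of_eq ?_).trans this
  rw [← norm_neg, add_smul]
  congr 1
  abel

section SeparableSystem

variable {A B : Type*} [NormedAddCommGroup A] [NormedSpace ℝ A] [NormedAddCommGroup B]
  [NormedSpace ℝ B]

/-- One step of the symplectic Euler scheme for `a' = F b`, `b' = G a`. -/
def symplecticEuler (F : B → A) (G : A → B) (h : ℝ) (x : A × B) : A × B :=
  (x.1 + h • F x.2, x.2 + h • G (x.1 + h • F x.2))

theorem measurePreserving_symplecticEuler [MeasurableSpace A] [BorelSpace A]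
    [MeasurableSpace B] [BorelSpace B] [SecondCountableTopology A] [SecondCountableTopology B]
    (μ : Measure A) [SFinite μ] [μ.IsAddRightInvariant]
    (ν : Measure B) [SFinite ν] [ν.IsAddRightInvariant]
    {F : B → A} {G : A → B} (hF : Continuous F) (hG : Continuous G) (h : ℝ) :
    MeasurePreserving (symplecticEuler F G h) (μ.prod ν) (μ.prod ν) := by
  have hA : MeasurePreserving (fun x : B × A => (x.1, x.2 + h • F x.1)) (ν.prod μ) (ν.prod μ) :=
    (MeasurePreserving.id ν).skew_product (g := fun b a => a + h • F b)
      (by unfold Function.uncurry; fun_prop)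
      (ae_of_all _ fun b => map_add_right_eq_self μ _)
  have hB : MeasurePreserving (fun x : A × B => (x.1, x.2 + h • G x.1)) (μ.prod ν) (μ.prod ν) :=
    (MeasurePreserving.id μ).skew_product (g := fun a b => b + h • G a)
      (by unfold Function.uncurry; fun_prop)
      (ae_of_all _ fun b => map_add_right_eq_self ν _)
  exact hB.comp ((Measure.measurePreserving_swap.comp hA).comp Measure.measurePreserving_swap)

theorem norm_symplecticEuler_sub_le {F : B → A} {G : A → B} {L : ℝ≥0}
    (hF : LipschitzWith L F) (hG : LipschitzWith L G) {h : ℝ} (hh : 0 ≤ h) (x y : A × B) :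
    ‖symplecticEuler F G h x - symplecticEuler F G h y‖ ≤ Real.exp (2 * L * h) * ‖x - y‖ := by
  have hL : (0 : ℝ) ≤ L := L.2
  set d := ‖x - y‖
  have hd : 0 ≤ d := norm_nonneg _
  have h1 : ‖x.1 - y.1‖ ≤ d := norm_fst_le (x - y)
  have h2 : ‖x.2 - y.2‖ ≤ d := norm_snd_le (x - y)
  have e1 : ‖(x.1 + h • F x.2) - (y.1 + h • F y.2)‖ ≤ (1 + h * L) * d := by
    refine (norm_add_smul_sub_le hF hh _ _ _ _).trans ?_
    have : h * (L * ‖x.2 - y.2‖) ≤ h * (L * d) := by gcongr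
    linarith
  have e2 : ‖(symplecticEuler F G h x).2 - (symplecticEuler F G h y).2‖
      ≤ d + h * (L * ((1 + h * L) * d)) := by
    refine (norm_add_smul_sub_le hG hh _ _ _ _).trans ?_
    gcongr
  have hexp : (1 + h * L) ^ 2 ≤ Real.exp (2 * L * h) := by
    have := Real.add_one_le_exp (h * L)
    calc (1 + h * L) ^ 2 ≤ Real.exp (h * L) ^ 2 := by gcongr; linarith
      _ = _ := by rw [← Real.exp_nat_mul]; congr 1; push_cast; ring
  have hhL : 0 ≤ h * L := by positivity
  refine max_le (e1.trans ?_) (e2.trans ?_)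
  · gcongr
    nlinarith
  · calc d + h * (L * ((1 + h * L) * d)) = (1 + h * L + (h * L) ^ 2) * d := by ring
      _ ≤ Real.exp (2 * L * h) * d := by
        gcongr
        nlinarith

theorem norm_symplecticEuler_sub_solution_le {F : B → A} {G : A → B} {L : ℝ≥0}
    (hF : LipschitzWith L F) (hG : LipschitzWith L G) {w : ℝ → A × B}
    (hw : ∀ t, HasDerivAt w (F (w t).2, G (w t).1) t) {D : ℝ} {t h : ℝ} (hh : 0 ≤ h)
    (hDF : ∀ s ∈ Icc t (t + h), ‖F (w s).2‖ ≤ D) (hDG : ∀ s ∈ Icc t (t + h), ‖G (w s).1‖ ≤ D) :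
    ‖symplecticEuler F G h (w t) - w (t + h)‖ ≤ 2 * L * D * h ^ 2 := by
  have hL : (0 : ℝ) ≤ L := L.2
  have ht : t ∈ Icc t (t + h) := ⟨le_rfl, by linarith⟩
  have hD : 0 ≤ D := (norm_nonneg _).trans (hDF t ht)
  have d1 : ∀ s, HasDerivAt (fun s => (w s).1) (F (w s).2) s := fun s => (hw s).fst
  have d2 : ∀ s, HasDerivAt (fun s => (w s).2) (G (w s).1) s := fun s => (hw s).snd
  have hsub : ∀ s ∈ Icc t (t + h), ‖s - t‖ ≤ h := fun s hs => by
    rw [Real.norm_of_nonneg (by linarith [hs.1])]; linarith [hs.2]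
  have m1 : ∀ s ∈ Icc t (t + h), ‖(w s).1 - (w t).1‖ ≤ D * h := fun s hs =>
    ((convex_Icc t (t + h)).norm_image_sub_le_of_norm_hasDerivWithin_le
      (fun s _ => (d1 s).hasDerivWithinAt) hDF ht hs).trans (by gcongr; exact hsub s hs)
  have m2 : ∀ s ∈ Icc t (t + h), ‖(w s).2 - (w t).2‖ ≤ D * h := fun s hs =>
    ((convex_Icc t (t + h)).norm_image_sub_le_of_norm_hasDerivWithin_le
      (fun s _ => (d2 s).hasDerivWithinAt) hDG ht hs).trans (by gcongr; exact hsub s hs)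
  have hC : 2 * L * D * h ^ 2 = L * (2 * D * h) * h := by ring
  rw [hC]
  refine max_le (norm_add_smul_sub_le_of_hasDerivAt hh d1 fun s hs => ?_)
    (norm_add_smul_sub_le_of_hasDerivAt hh d2 fun s hs => ?_)
  · refine (hF.norm_sub_le _ _).trans ?_
    gcongr
    have := m2 s hs
    have : 0 ≤ D * h := by positivity
    linarith
  · refine (hG.norm_sub_le _ _).trans ?_
    gcongr
    calc ‖(w s).1 - ((w t).1 + h • F (w t).2)‖ = ‖(w s).1 - (w t).1 - h • F (w t).2‖ := by
          congr 1; abel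
      _ ≤ ‖(w s).1 - (w t).1‖ + ‖h • F (w t).2‖ := norm_sub_le _ _
      _ ≤ D * h + h * D := by
          rw [norm_smul, Real.norm_of_nonneg hh]
          gcongr
          exacts [m1 s hs, hDF t ht]
      _ = _ := by ring

/-- The symplectic Euler scheme converges to the solution at time one. -/
theorem tendsto_iterate_symplecticEuler {F : B → A} {G : A → B} {L : ℝ≥0}
    (hF : LipschitzWith L F) (hG : LipschitzWith L G) {w : ℝ → A × B}
    (hw : ∀ t, HasDerivAt w (F (w t).2, G (w t).1) t) :
    Tendsto (fun n : ℕ => (symplecticEuler F G (1 / ((n : ℝ) + 1)))^[n + 1] (w 0)) atTop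
      (𝓝 (w 1)) := by
  have hwc : Continuous w := continuous_iff_continuousAt.2 fun t => (hw t).continuousAt
  obtain ⟨D₁, hD₁⟩ := (isCompact_Icc (a := (0 : ℝ)) (b := 1)).exists_bound_of_continuousOn
    (hF.continuous.comp hwc.snd).continuousOn
  obtain ⟨D₂, hD₂⟩ := (isCompact_Icc (a := (0 : ℝ)) (b := 1)).exists_bound_of_continuousOn
    (hG.continuous.comp hwc.fst).continuousOn
  set D := max D₁ D₂
  have hL : (0 : ℝ) ≤ L := L.2
  have hD : 0 ≤ D :=
    ((norm_nonneg _).trans (hD₁ 0 (by simp))).trans (le_max_left _ _)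
  have bound : ∀ n : ℕ, ‖(symplecticEuler F G (1 / ((n : ℝ) + 1)))^[n + 1] (w 0) - w 1‖
      ≤ 2 * L * D * Real.exp (2 * L) * (1 / ((n : ℝ) + 1)) := by
    intro n
    set h : ℝ := 1 / ((n : ℝ) + 1) with hh_def
    have hn : (0 : ℝ) < n + 1 := by positivity
    have hh : 0 ≤ h := by positivity
    have hnh : (n + 1) * h = 1 := by rw [hh_def]; field_simp
    have step : ∀ k : ℕ, k ≤ n + 1 →
        ‖(symplecticEuler F G h)^[k] (w 0) - w (k * h)‖
          ≤ k * (2 * L * D * h ^ 2) * Real.exp (2 * L * (k * h)) := by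
      intro k
      induction k with
      | zero => simp
      | succ k ih =>
        intro hk
        have hk' : (k : ℝ) * h + h ≤ 1 := by
          rw [← hnh, ← add_one_mul]
          gcongr
          exact_mod_cast (by omega : k ≤ n)
        have hsub : ∀ s ∈ Icc ((k : ℝ) * h) (k * h + h), s ∈ Icc (0 : ℝ) 1 := fun s hs =>
          ⟨le_trans (by positivity) hs.1, hs.2.trans hk'⟩
        rw [Function.iterate_succ_apply']
        push_cast
        rw [add_one_mul]
        have e1 := norm_symplecticEuler_sub_solution_le hF hG hw hh
          (fun s hs => (hD₁ s (hsub s hs)).trans (le_max_left D₁ D₂))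
          (fun s hs => (hD₂ s (hsub s hs)).trans (le_max_right D₁ D₂))
        have e2 := norm_symplecticEuler_sub_le hF hG hh ((symplecticEuler F G h)^[k] (w 0))
          (w (k * h))
        have e3 := ih (by omega)
        have e4 : 1 ≤ Real.exp (2 * L * (k * h + h)) := Real.one_le_exp (by positivity)
        calc _ ≤ _ := norm_sub_le_norm_sub_add_norm_sub _
                (symplecticEuler F G h (w (k * h))) _
          _ ≤ Real.exp (2 * L * h) * (k * (2 * L * D * h ^ 2) * Real.exp (2 * L * (k * h)))
              + 2 * L * D * h ^ 2 * 1 := by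
                rw [mul_one]
                exact add_le_add (e2.trans (by gcongr)) e1
          _ ≤ Real.exp (2 * L * h) * (k * (2 * L * D * h ^ 2) * Real.exp (2 * L * (k * h)))
              + 2 * L * D * h ^ 2 * Real.exp (2 * L * (k * h + h)) := by gcongr
          _ = _ := by
                rw [mul_add (2 * (L : ℝ)), Real.exp_add]
                ring
    have := step (n + 1) le_rfl
    push_cast at this
    rw [hnh] at this
    refine this.trans_eq ?_
    rw [mul_one]
    calc _ = ((n + 1) * h) * (2 * L * D * h) * Real.exp (2 * L) := by ring
      _ = _ := by rw [hnh]; ring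
  rw [tendsto_iff_norm_sub_tendsto_zero]
  refine squeeze_zero (fun _ => norm_nonneg _) bound ?_
  simpa using tendsto_one_div_add_atTop_nhds_zero_nat.const_mul
    (2 * L * D * Real.exp (2 * L))

/-- Poincaré recurrence for the flow of a separable system `a' = F b`, `b' = G a` which has a
conserved quantity with sublevel sets of finite measure. -/
theorem ae_frequently_flow_mem [FiniteDimensional ℝ A] [FiniteDimensional ℝ B]
    [MeasurableSpace A] [BorelSpace A] [MeasurableSpace B] [BorelSpace B]
    (μ : Measure A) [μ.IsAddHaarMeasure] (ν : Measure B) [ν.IsAddHaarMeasure]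
    {F : B → A} {G : A → B} {L : ℝ≥0} (hF : LipschitzWith L F) (hG : LipschitzWith L G)
    {Ψ : A × B → ℝ → A × B} (hΨ0 : ∀ x, Ψ x 0 = x)
    (hΨ : ∀ x t, HasDerivAt (Ψ x) (F (Ψ x t).2, G (Ψ x t).1) t)
    {H : A × B → ℝ} (hH : Measurable H) (hinv : ∀ x t, H (Ψ x t) = H x)
    (hfin : ∀ c : ℝ, μ.prod ν {x | H x ≤ c} < ∞) :
    ∀ᵐ x ∂μ.prod ν, ∀ s ∈ 𝓝 x, ∃ᶠ n : ℕ in atTop, Ψ x n ∈ s := by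
  have : ProperSpace A := FiniteDimensional.proper ℝ A
  have : ProperSpace B := FiniteDimensional.proper ℝ B
  have hlim : ∀ x, Tendsto (fun n : ℕ => (symplecticEuler F G (1 / ((n : ℝ) + 1)))^[n + 1] x)
      atTop (𝓝 (Ψ x 1)) := fun x => by
    simpa only [hΨ0] using tendsto_iterate_symplecticEuler hF hG (hΨ x)
  have hmp : ∀ n : ℕ, MeasurePreserving ((symplecticEuler F G (1 / ((n : ℝ) + 1)))^[n + 1])
      (μ.prod ν) (μ.prod ν) := fun n =>
    (measurePreserving_symplecticEuler μ ν hF.continuous hG.continuous _).iterate _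
  have hmeas : Measurable fun x => Ψ x 1 :=
    measurable_of_tendsto_metrizable (fun n => (hmp n).measurable) (tendsto_pi_nhds.2 hlim)
  have hiter : ∀ x (n : ℕ), (fun x => Ψ x 1)^[n] x = Ψ x n := by
    intro x n
    induction n with
    | zero => simp [hΨ0]
    | succ n ih =>
      rw [Function.iterate_succ_apply', ih]
      have h := tendsto_iterate_symplecticEuler hF hG (w := fun t => Ψ x (n + t))
        fun t => (hΨ x (n + t)).comp_const_add _ _
      simp only [add_zero] at h
      rw [Nat.cast_succ]
      exact tendsto_nhds_unique (hlim _) h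
  simpa only [hiter] using ae_frequently_iterate_mem_of_invariant hmeas
    (map_le_of_tendsto_measurePreserving hmp hlim) hH (fun x => hinv x 1) hfin

end SeparableSystem

/-- Null sets are preserved by differentiable maps between spaces of equal dimension. -/
theorem addHaar_image_eq_zero_of_differentiable_of_finrank_eq {E E' : Type*}
    [NormedAddCommGroup E] [NormedSpace ℝ E] [FiniteDimensional ℝ E] [MeasurableSpace E]
    [BorelSpace E] [NormedAddCommGroup E'] [NormedSpace ℝ E'] [FiniteDimensional ℝ E']
    [MeasurableSpace E'] [BorelSpace E'] (hdim : Module.finrank ℝ E = Module.finrank ℝ E')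
    (μ : Measure E) [μ.IsAddHaarMeasure] (ν : Measure E') [ν.IsAddHaarMeasure]
    {f : E → E'} (hf : Differentiable ℝ f) {s : Set E} (hs : μ s = 0) : ν (f '' s) = 0 := by
  have : ProperSpace E := FiniteDimensional.proper ℝ E
  let e : E ≃L[ℝ] E' := ContinuousLinearEquiv.ofFinrankEq hdim
  have hnull : μ ((e.symm ∘ f) '' s) = 0 :=
    addHaar_image_eq_zero_of_differentiableOn_of_addHaar_eq_zero μ
      (e.symm.differentiable.comp hf).differentiableOn hs
  have hac : ν.map e.symm ≪ μ := Measure.absolutelyContinuous_isAddHaarMeasure _ _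
  have := hac hnull
  rw [image_comp] at this
  rw [← e.symm.injective.preimage_image (f '' s)]
  exact (e.symm.toHomeomorph.toMeasurableEquiv.map_apply _).symm.trans this

theorem two_add_two_cosh_pos (x : ℝ) : 0 < 2 + 2 * Real.cosh x := by
  have := Real.cosh_pos x
  positivity

theorem deriv_sigmoid_eq_inv (x : ℝ) : deriv Real.sigmoid x = (2 + 2 * Real.cosh x)⁻¹ := by
  rw [Real.deriv_sigmoid]
  simp only [Real.sigmoid_def, Real.cosh_eq, Real.exp_neg]
  have := Real.exp_pos x
  field_simp
  ring

theorem hasDerivAt_two_mul_add_two_mul_sinh (x : ℝ) :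
    HasDerivAt (fun x : ℝ => 2 * x + 2 * Real.sinh x) (2 + 2 * Real.cosh x) x := by
  exact (((hasDerivAt_id x).const_mul 2).add ((Real.hasDerivAt_sinh x).const_mul 2)).congr_deriv
    (by ring)

/-- The primitive `2 x + 2 sinh x` of `1 / sigmoid'`, as a change of coordinates on the line.
In this coordinate the hidden game dynamics is divergence free. -/
noncomputable def hiddenCoord : ℝ ≃ₜ ℝ :=
  (StrictMono.orderIsoOfSurjective (fun x : ℝ => 2 * x + 2 * Real.sinh x)
    (strictMono_of_hasDerivAt_pos hasDerivAt_two_mul_add_two_mul_sinh two_add_two_cosh_pos)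
    ((by fun_prop : Continuous fun x : ℝ => 2 * x + 2 * Real.sinh x).surjective
      (tendsto_atTop_mono' atTop ((eventually_ge_atTop 0).mono fun x hx => by
        have := Real.self_le_sinh_iff.2 hx
        change x ≤ _
        linarith) tendsto_id)
      (tendsto_atBot_mono' atBot ((eventually_le_atBot 0).mono fun x hx => by
        have := Real.sinh_le_self_iff.2 hx
        change _ ≤ x
        linarith) tendsto_id))).toHomeomorph

theorem hasDerivAt_hiddenCoord (x : ℝ) :
    HasDerivAt hiddenCoord (2 + 2 * Real.cosh x) x :=
  hasDerivAt_two_mul_add_two_mul_sinh x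

theorem hasDerivAt_hiddenCoord_symm (y : ℝ) :
    HasDerivAt hiddenCoord.symm (2 + 2 * Real.cosh (hiddenCoord.symm y))⁻¹ y :=
  (hasDerivAt_hiddenCoord _).of_local_left_inverse hiddenCoord.symm.continuous.continuousAt
    (two_add_two_cosh_pos _).ne' (Eventually.of_forall hiddenCoord.apply_symm_apply)

theorem lipschitzWith_sigmoid_hiddenCoord_symm :
    LipschitzWith 1 fun y => Real.sigmoid (hiddenCoord.symm y) := by
  have hd : ∀ y, HasDerivAt (fun y => Real.sigmoid (hiddenCoord.symm y))
      ((2 + 2 * Real.cosh (hiddenCoord.symm y))⁻¹ *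
        (2 + 2 * Real.cosh (hiddenCoord.symm y))⁻¹) y := fun y => by
    have h := differentiable_sigmoid.differentiableAt.hasDerivAt (x := hiddenCoord.symm y)
    rw [deriv_sigmoid_eq_inv] at h
    exact h.comp y (hasDerivAt_hiddenCoord_symm y)
  refine lipschitzWith_of_nnnorm_deriv_le (fun y => (hd y).differentiableAt) fun y => ?_
  rw [(hd y).deriv, ← NNReal.coe_le_coe, coe_nnnorm]
  have h1 : (2 + 2 * Real.cosh (hiddenCoord.symm y))⁻¹ ≤ 1 :=
    inv_le_one_of_one_le₀ (by linarith [Real.cosh_pos (hiddenCoord.symm y)])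
  have h0 := (inv_pos.2 (two_add_two_cosh_pos (hiddenCoord.symm y))).le
  rw [Real.norm_of_nonneg (by positivity)]
  exact mul_le_one₀ h1 h0 h1

/-- The gradient of the hidden Lagrangian with respect to one player's variables and the
opposing multiplier, written in hidden coordinates. -/
noncomputable def hiddenGradient {ι κ : Type*} [Fintype κ] (u : ι → κ → ℝ)
    (x : (κ → ℝ) × ℝ) : (ι → ℝ) × ℝ :=
  (fun i => ∑ j, u i j * Real.sigmoid (hiddenCoord.symm (x.1 j)) + x.2,
    ∑ j, Real.sigmoid (hiddenCoord.symm (x.1 j)) - 1)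

theorem exists_lipschitzWith_hiddenGradient {ι κ : Type*} [Fintype ι] [Fintype κ]
    (u : ι → κ → ℝ) : ∃ L, LipschitzWith L (hiddenGradient u) := by
  have key : ∀ (c : κ → ℝ) (x y : (κ → ℝ) × ℝ),
      |∑ j, c j * Real.sigmoid (hiddenCoord.symm (x.1 j))
        - ∑ j, c j * Real.sigmoid (hiddenCoord.symm (y.1 j))| ≤ (∑ j, |c j|) * ‖x - y‖ := by
    intro c x y
    rw [← Finset.sum_sub_distrib, Finset.sum_mul]
    refine (Finset.abs_sum_le_sum_abs _ _).trans (Finset.sum_le_sum fun j _ => ?_)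
    rw [← mul_sub, abs_mul]
    gcongr
    have h1 := lipschitzWith_sigmoid_hiddenCoord_symm.norm_sub_le (x.1 j) (y.1 j)
    have h2 := (norm_le_pi_norm (x - y).1 j).trans (norm_fst_le (x - y))
    simp only [NNReal.coe_one, one_mul, Real.norm_eq_abs] at h1
    exact h1.trans h2
  have hC : ∀ i, ∑ j, |u i j| ≤ ∑ i, ∑ j, |u i j| := fun i =>
    Finset.single_le_sum (f := fun i => ∑ j, |u i j|)
      (fun _ _ => Finset.sum_nonneg fun _ _ => abs_nonneg _) (Finset.mem_univ i)
  have hC0 : 0 ≤ ∑ i, ∑ j, |u i j| :=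
    Finset.sum_nonneg fun _ _ => Finset.sum_nonneg fun _ _ => abs_nonneg _
  refine ⟨Real.toNNReal ((∑ i, ∑ j, |u i j|) + 1 + ∑ _j : κ, |(1 : ℝ)|),
    LipschitzWith.of_dist_le_mul fun x y => ?_⟩
  have hK : 0 ≤ ∑ _j : κ, |(1 : ℝ)| := Finset.sum_nonneg fun _ _ => abs_nonneg _
  rw [Real.coe_toNNReal _ (by positivity), dist_eq_norm, dist_eq_norm]
  set d := ‖x - y‖
  have hd : 0 ≤ d := norm_nonneg _
  refine max_le ((pi_norm_le_iff_of_nonneg (by positivity)).2 fun i => ?_) ?_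
  · have h1 := key (u i) x y
    have h2 : |x.2 - y.2| ≤ d := norm_snd_le (x - y)
    have h3 := mul_le_mul_of_nonneg_right (hC i) hd
    have h4 : 0 ≤ (∑ _j : κ, |(1 : ℝ)|) * d := by positivity
    simp only [hiddenGradient, Prod.fst_sub, Pi.sub_apply, Real.norm_eq_abs]
    rw [add_sub_add_comm]
    refine (abs_add_le _ _).trans ?_
    linarith
  · have h1 := key (fun _ => 1) x y
    have h4 : 0 ≤ ((∑ i, ∑ j, |u i j|) + 1) * d := by positivity
    simp only [one_mul] at h1
    simp only [hiddenGradient, Prod.snd_sub, Real.norm_eq_abs]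
    rw [sub_sub_sub_cancel_right]
    linarith

/-- A primitive of `(sigmoid - p) / sigmoid'`. -/
noncomputable def hiddenPotential (p x : ℝ) : ℝ :=
  (1 - 2 * p) * x + (1 - p) * Real.exp x + p * Real.exp (-x)

theorem continuous_hiddenPotential (p : ℝ) : Continuous (hiddenPotential p) := by
  unfold hiddenPotential
  fun_prop

theorem hasDerivAt_hiddenPotential (p x : ℝ) :
    HasDerivAt (hiddenPotential p) ((2 + 2 * Real.cosh x) * (Real.sigmoid x - p)) x := by
  have h := (((hasDerivAt_id x).const_mul (1 - 2 * p)).add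
    ((Real.hasDerivAt_exp x).const_mul (1 - p))).add (((hasDerivAt_neg x).exp).const_mul p)
  refine h.congr_deriv ?_
  simp only [Real.sigmoid_def, Real.cosh_eq, Real.exp_neg]
  have := Real.exp_pos x
  field_simp
  ring

theorem exists_abs_sub_le_hiddenPotential {p : ℝ} (hp : p ∈ Ioo (0 : ℝ) 1) :
    ∃ K, ∀ x, |x| - K ≤ hiddenPotential p x := by
  obtain ⟨hp0, hp1⟩ := hp
  set m := min p (1 - p)
  have hm : 0 < m := lt_min hp0 (by linarith)
  refine ⟨2 / m, fun x => ?_⟩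
  have h1 : m * Real.exp x ≤ (1 - p) * Real.exp x := by gcongr; exact min_le_right _ _
  have h2 : m * Real.exp (-x) ≤ p * Real.exp (-x) := by gcongr; exact min_le_left _ _
  have h3 : -|x| ≤ (1 - 2 * p) * x := by
    refine neg_le_of_abs_le ?_
    rw [abs_mul]
    exact mul_le_of_le_one_left (abs_nonneg x) (abs_le.2 ⟨by linarith, by linarith⟩)
  have h4 : 2 + x ^ 2 / 2 ≤ Real.exp x + Real.exp (-x) := by
    have h := Real.quadratic_le_exp_of_nonneg (abs_nonneg x)
    have h' := Real.add_one_le_exp (-|x|)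
    have : Real.exp |x| + Real.exp (-|x|) = Real.exp x + Real.exp (-x) := by
      rcases abs_cases x with ⟨hx, _⟩ | ⟨hx, _⟩ <;> rw [hx]
      rw [neg_neg, add_comm]
    nlinarith [sq_abs x]
  have h5 : m * (2 + x ^ 2 / 2) ≤ m * (Real.exp x + Real.exp (-x)) := by gcongr
  have h6 : 2 * |x| - 2 / m ≤ m * (x ^ 2 / 2) := by
    have : m / 2 * (|x| - 2 / m) ^ 2 = m * (x ^ 2 / 2) - 2 * |x| + 2 / m := by
      rw [sub_sq, sq_abs]
      field_simp
    nlinarith [mul_nonneg hm.le (sq_nonneg (|x| - 2 / m))]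
  unfold hiddenPotential
  nlinarith

section HiddenGame

variable {N M : ℕ}

/-- The conserved quantity of the hidden bilinear zero-sum game with multipliers. -/
noncomputable def hiddenEnergy (p : Fin N → ℝ) (q : Fin M → ℝ) (lamStar muStar : ℝ)
    (x : (Fin N → ℝ) × (Fin M → ℝ) × ℝ × ℝ) : ℝ :=
  ∑ i, hiddenPotential (p i) (x.1 i) + ∑ j, hiddenPotential (q j) (x.2.1 j)
    + (x.2.2.1 - lamStar) ^ 2 / 2 + (x.2.2.2 - muStar) ^ 2 / 2

theorem continuous_hiddenEnergy (p : Fin N → ℝ) (q : Fin M → ℝ) (lamStar muStar : ℝ) :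
    Continuous (hiddenEnergy p q lamStar muStar) := by
  have := continuous_hiddenPotential
  unfold hiddenEnergy
  fun_prop

theorem isCompact_hiddenEnergy_le {p : Fin N → ℝ} {q : Fin M → ℝ}
    (hp : ∀ i, p i ∈ Ioo (0 : ℝ) 1) (hq : ∀ j, q j ∈ Ioo (0 : ℝ) 1) (lamStar muStar c : ℝ) :
    IsCompact {x | hiddenEnergy p q lamStar muStar x ≤ c} := by
  choose K hK using fun i => exists_abs_sub_le_hiddenPotential (hp i)
  choose K' hK' using fun j => exists_abs_sub_le_hiddenPotential (hq j)
  have hsq : ∀ a b : ℝ, |a| - (|b| + 1) ≤ (a - b) ^ 2 / 2 := fun a b => by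
    have h1 : |a| ≤ |a - b| + |b| := by simpa using abs_add_le (a - b) b
    nlinarith [sq_nonneg (|a - b| - 1), sq_abs (a - b)]
  set R := c + ∑ i, K i + ∑ j, K' j + (|lamStar| + 1) + (|muStar| + 1)
  refine Metric.isCompact_of_isClosed_isBounded
    (isClosed_le (continuous_hiddenEnergy p q lamStar muStar) continuous_const)
    (isBounded_iff_forall_norm_le.2 ⟨R, fun x hx => ?_⟩)
  have h1 : ∑ i, |x.1 i| - ∑ i, K i ≤ ∑ i, hiddenPotential (p i) (x.1 i) := by
    rw [← Finset.sum_sub_distrib]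
    exact Finset.sum_le_sum fun i _ => hK i _
  have h2 : ∑ j, |x.2.1 j| - ∑ j, K' j ≤ ∑ j, hiddenPotential (q j) (x.2.1 j) := by
    rw [← Finset.sum_sub_distrib]
    exact Finset.sum_le_sum fun j _ => hK' j _
  have h3 := hsq x.2.2.1 lamStar
  have h4 := hsq x.2.2.2 muStar
  have hx' : ∑ i, hiddenPotential (p i) (x.1 i) + ∑ j, hiddenPotential (q j) (x.2.1 j)
    + (x.2.2.1 - lamStar) ^ 2 / 2 + (x.2.2.2 - muStar) ^ 2 / 2 ≤ c := hx
  have hsum : ∑ i, |x.1 i| + ∑ j, |x.2.1 j| + |x.2.2.1| + |x.2.2.2| ≤ R := by linarith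
  have n1 : 0 ≤ ∑ i, |x.1 i| := Finset.sum_nonneg fun _ _ => abs_nonneg _
  have n2 : 0 ≤ ∑ j, |x.2.1 j| := Finset.sum_nonneg fun _ _ => abs_nonneg _
  have n3 := abs_nonneg x.2.2.1
  have n4 := abs_nonneg x.2.2.2
  have hR : 0 ≤ R := by linarith
  refine max_le ((pi_norm_le_iff_of_nonneg hR).2 fun i => ?_)
    (max_le ((pi_norm_le_iff_of_nonneg hR).2 fun j => ?_) (max_le ?_ ?_))
  · have := Finset.single_le_sum (f := fun i => |x.1 i|) (fun _ _ => abs_nonneg _)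
      (Finset.mem_univ i)
    rw [Real.norm_eq_abs]
    linarith
  · have := Finset.single_le_sum (f := fun j => |x.2.1 j|) (fun _ _ => abs_nonneg _)
      (Finset.mem_univ j)
    rw [Real.norm_eq_abs]
    linarith
  all_goals
    rw [Real.norm_eq_abs]
    linarith

/-- The gradient-descent-ascent vector field of the hidden game. -/
noncomputable def hiddenGDA (u : Matrix (Fin N) (Fin M) ℝ)
    (x : (Fin N → ℝ) × (Fin M → ℝ) × ℝ × ℝ) : (Fin N → ℝ) × (Fin M → ℝ) × ℝ × ℝ :=
  (fun i => -(deriv Real.sigmoid (x.1 i) *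
      ((∑ j, u i j * Real.sigmoid (x.2.1 j)) + x.2.2.1)),
    fun j => deriv Real.sigmoid (x.2.1 j) *
      ((∑ i, u i j * Real.sigmoid (x.1 i)) + x.2.2.2),
    (∑ i, Real.sigmoid (x.1 i)) - 1,
    -((∑ j, Real.sigmoid (x.2.1 j)) - 1))

theorem sum_mul_sub_sum_mul_eq_zero {ι κ : Type*} [Fintype ι] [Fintype κ] (u : ι → κ → ℝ)
    {p a : ι → ℝ} {q b : κ → ℝ} (hp : ∑ i, p i = 1) (hq : ∑ j, q j = 1) {lamStar muStar : ℝ}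
    (h1 : ∀ i, ∑ j, u i j * q j + lamStar = 0) (h2 : ∀ j, ∑ i, u i j * p i + muStar = 0)
    (l m : ℝ) :
    -∑ i, (a i - p i) * (∑ j, u i j * b j + l) + ∑ j, (b j - q j) * (∑ i, u i j * a i + m)
      + (l - lamStar) * (∑ i, a i - 1) - (m - muStar) * (∑ j, b j - 1) = 0 := by
  have e1 : ∀ i, ∑ j, u i j * b j + l = ∑ j, u i j * (b j - q j) + (l - lamStar) := fun i => by
    simp only [mul_sub, Finset.sum_sub_distrib]
    linarith [h1 i]
  have e2 : ∀ j, ∑ i, u i j * a i + m = ∑ i, u i j * (a i - p i) + (m - muStar) := fun j => by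
    simp only [mul_sub, Finset.sum_sub_distrib]
    linarith [h2 j]
  have e3 : ∑ i, (a i - p i) * ∑ j, u i j * (b j - q j)
      = ∑ j, (b j - q j) * ∑ i, u i j * (a i - p i) := by
    simp only [Finset.mul_sum]
    rw [Finset.sum_comm]
    exact Finset.sum_congr rfl fun j _ => Finset.sum_congr rfl fun i _ => by ring
  simp only [e1, e2, mul_add, Finset.sum_add_distrib, ← Finset.sum_mul, e3,
    Finset.sum_sub_distrib, hp, hq]
  ring

theorem hiddenEnergy_eq_of_hasDerivAt {u : Matrix (Fin N) (Fin M) ℝ} {p : Fin N → ℝ}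
    {q : Fin M → ℝ} (hp : ∑ i, p i = 1) (hq : ∑ j, q j = 1) {lamStar muStar : ℝ}
    (h1 : ∀ i, ∑ j, u i j * q j + lamStar = 0) (h2 : ∀ j, ∑ i, u i j * p i + muStar = 0)
    {w : ℝ → (Fin N → ℝ) × (Fin M → ℝ) × ℝ × ℝ}
    (hw : ∀ t, HasDerivAt w (hiddenGDA u (w t)) t) (s t : ℝ) :
    hiddenEnergy p q lamStar muStar (w s) = hiddenEnergy p q lamStar muStar (w t) := by
  have hd : ∀ t, HasDerivAt (fun t => hiddenEnergy p q lamStar muStar (w t)) 0 t := by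
    intro t
    have d1 := hasDerivAt_pi.1 (hw t).fst
    have d2 := hasDerivAt_pi.1 (hw t).snd.fst
    have d3 := (hw t).snd.snd.fst
    have d4 := (hw t).snd.snd.snd
    have k1 := HasDerivAt.fun_sum (u := Finset.univ) fun i _ =>
      (hasDerivAt_hiddenPotential (p i) ((w t).1 i)).comp t (d1 i)
    have k2 := HasDerivAt.fun_sum (u := Finset.univ) fun j _ =>
      (hasDerivAt_hiddenPotential (q j) ((w t).2.1 j)).comp t (d2 j)
    have k := ((k1.add k2).add ((HasDerivAt.fun_pow (d3.sub_const lamStar) 2).div_const 2)).add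
      ((HasDerivAt.fun_pow (d4.sub_const muStar) 2).div_const 2)
    refine k.congr_deriv ?_
    have c : ∀ x a b : ℝ, (2 + 2 * Real.cosh x) * a * (deriv Real.sigmoid x * b) = a * b :=
      fun x a b => by
        rw [deriv_sigmoid_eq_inv]
        have := (two_add_two_cosh_pos x).ne'
        field_simp
    have := sum_mul_sub_sum_mul_eq_zero (fun i j => u i j)
      (a := fun i => Real.sigmoid ((w t).1 i)) (b := fun j => Real.sigmoid ((w t).2.1 j))
      hp hq h1 h2 (w t).2.2.1 (w t).2.2.2
    simp only [hiddenGDA, mul_neg, c, Finset.sum_neg_distrib]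
    rw [← this]
    push_cast
    ring
  exact is_const_of_deriv_eq_zero (fun t => (hd t).differentiableAt) (fun t => (hd t).deriv) s t

/-- Hidden coordinates which separate the system into `(θ, μ)` and `(φ, λ)`. -/
noncomputable def separatedCoord (N M : ℕ) :
    (Fin N → ℝ) × (Fin M → ℝ) × ℝ × ℝ ≃ₜ ((Fin N → ℝ) × ℝ) × ((Fin M → ℝ) × ℝ) where
  toFun x := ((fun i => hiddenCoord (x.1 i), x.2.2.2), (fun j => hiddenCoord (x.2.1 j), x.2.2.1))
  invFun y := (fun i => hiddenCoord.symm (y.1.1 i), fun j => hiddenCoord.symm (y.2.1 j),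
    y.2.2, y.1.2)
  left_inv x := by simp
  right_inv y := by simp
  continuous_toFun := by
    have := hiddenCoord.continuous
    fun_prop
  continuous_invFun := by
    have := hiddenCoord.symm.continuous
    fun_prop

theorem differentiable_separatedCoord_symm : Differentiable ℝ (separatedCoord N M).symm := by
  have : Differentiable ℝ hiddenCoord.symm := fun y =>
    (hasDerivAt_hiddenCoord_symm y).differentiableAt
  change Differentiable ℝ fun y : ((Fin N → ℝ) × ℝ) × ((Fin M → ℝ) × ℝ) =>
    ((fun i => hiddenCoord.symm (y.1.1 i), fun j => hiddenCoord.symm (y.2.1 j), y.2.2, y.1.2) :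
      (Fin N → ℝ) × (Fin M → ℝ) × ℝ × ℝ)
  fun_prop

theorem hasDerivAt_separatedCoord {u : Matrix (Fin N) (Fin M) ℝ}
    {w : ℝ → (Fin N → ℝ) × (Fin M → ℝ) × ℝ × ℝ} {t : ℝ}
    (hw : HasDerivAt w (hiddenGDA u (w t)) t) :
    HasDerivAt (fun t => separatedCoord N M (w t))
      (-hiddenGradient (fun i j => u i j) (separatedCoord N M (w t)).2,
        hiddenGradient (fun j i => u i j) (separatedCoord N M (w t)).1) t := by
  have d1 := hasDerivAt_pi.1 hw.fst
  have d2 := hasDerivAt_pi.1 hw.snd.fst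
  have k1 := hasDerivAt_pi.2 fun i => (hasDerivAt_hiddenCoord ((w t).1 i)).comp t (d1 i)
  have k2 := hasDerivAt_pi.2 fun j => (hasDerivAt_hiddenCoord ((w t).2.1 j)).comp t (d2 j)
  refine ((k1.prodMk hw.snd.snd.snd).prodMk (k2.prodMk hw.snd.snd.fst)).congr_deriv ?_
  have c : ∀ x b : ℝ, (2 + 2 * Real.cosh x) * (deriv Real.sigmoid x * b) = b := fun x b => by
    rw [deriv_sigmoid_eq_inv, mul_inv_cancel_left₀ (two_add_two_cosh_pos x).ne']
  simp only [hiddenGDA, mul_neg, c]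
  ext <;> simp [hiddenGradient, separatedCoord]

end HiddenGame

/-- The flow of the continuous GDA vector field for a hidden bilinear
zero-sum game with sigmoid activations (one scalar parameter per strategy, with Lagrange
multipliers) is Poincaré recurrent: the set of non-recurrent points has Lebesgue measure
zero. -/
theorem stmt_18 {N M : ℕ} (σ : ℝ → ℝ) (hσ : ∀ x : ℝ, σ x = (1 + Real.exp (-x))⁻¹)
    (u : Matrix (Fin N) (Fin M) ℝ)
    (p : Fin N → ℝ) (q : Fin M → ℝ)
    (hp01 : ∀ i, p i ∈ Set.Ioo (0:ℝ) 1) (hq01 : ∀ j, q j ∈ Set.Ioo (0:ℝ) 1)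
    (hp : ∑ i, p i = 1) (hq : ∑ j, q j = 1)
    (lamStar muStar : ℝ)
    (hKKT1 : ∀ i, ∑ j, u i j * q j + lamStar = 0)
    (hKKT2 : ∀ j, ∑ i, u i j * p i + muStar = 0)
    (Y : (Fin N → ℝ) × (Fin M → ℝ) × ℝ × ℝ → (Fin N → ℝ) × (Fin M → ℝ) × ℝ × ℝ)
    (hY : ∀ x : (Fin N → ℝ) × (Fin M → ℝ) × ℝ × ℝ,
      Y x = (fun i => -(deriv σ (x.1 i) * ((∑ j, u i j * σ (x.2.1 j)) + x.2.2.1)),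
             fun j => deriv σ (x.2.1 j) * ((∑ i, u i j * σ (x.1 i)) + x.2.2.2),
             (∑ i, σ (x.1 i)) - 1,
             -((∑ j, σ (x.2.1 j)) - 1)))
    (Φ : ((Fin N → ℝ) × (Fin M → ℝ) × ℝ × ℝ) × ℝ → (Fin N → ℝ) × (Fin M → ℝ) × ℝ × ℝ)
    (hΦ0 : ∀ x, Φ (x, 0) = x)
    (hΦ : ∀ x t, HasDerivAt (fun s => Φ (x, s)) (Y (Φ (x, t))) t) :
    volume {x : (Fin N → ℝ) × (Fin M → ℝ) × ℝ × ℝ |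
      ∃ U : Set ((Fin N → ℝ) × (Fin M → ℝ) × ℝ × ℝ), IsOpen U ∧ x ∈ U ∧
        ∃ T : ℝ, ∀ t : ℝ, T < t → Φ (x, t) ∉ U} = 0 := by
  obtain rfl : σ = Real.sigmoid := funext fun x => (hσ x).trans (Real.sigmoid_def x).symm
  have hΦ' : ∀ x t, HasDerivAt (fun s => Φ (x, s)) (hiddenGDA u (Φ (x, t))) t := fun x t => by
    have h := hΦ x t
    rwa [hY] at h
  have hA : (volume : Measure ((Fin N → ℝ) × ℝ)).IsAddHaarMeasure :=
    Measure.prod.instIsAddHaarMeasure _ _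
  have hB : (volume : Measure ((Fin M → ℝ) × ℝ)).IsAddHaarMeasure :=
    Measure.prod.instIsAddHaarMeasure _ _
  have hR : (volume : Measure (ℝ × ℝ)).IsAddHaarMeasure :=
    Measure.prod.instIsAddHaarMeasure _ _
  have hMR : (volume : Measure ((Fin M → ℝ) × ℝ × ℝ)).IsAddHaarMeasure :=
    Measure.prod.instIsAddHaarMeasure _ _
  have hE : (volume : Measure ((Fin N → ℝ) × (Fin M → ℝ) × ℝ × ℝ)).IsAddHaarMeasure :=
    Measure.prod.instIsAddHaarMeasure _ _
  have hAB : ((volume : Measure ((Fin N → ℝ) × ℝ)).prod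
      (volume : Measure ((Fin M → ℝ) × ℝ))).IsAddHaarMeasure :=
    Measure.prod.instIsAddHaarMeasure _ _
  set T := separatedCoord N M
  obtain ⟨L₁, hL₁⟩ := exists_lipschitzWith_hiddenGradient fun i j => u i j
  obtain ⟨L₂, hL₂⟩ := exists_lipschitzWith_hiddenGradient fun j i => u i j
  have hrec := ae_frequently_flow_mem (A := (Fin N → ℝ) × ℝ) (B := (Fin M → ℝ) × ℝ)
    volume volume (F := fun y => -hiddenGradient (fun i j => u i j) y)
    (G := hiddenGradient fun j i => u i j) (L := max L₁ L₂)
    (hL₁.neg.weaken (le_max_left _ _)) (hL₂.weaken (le_max_right _ _))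
    (Ψ := fun x t => T (Φ (T.symm x, t))) (by simp [hΦ0])
    (fun x t => hasDerivAt_separatedCoord (hΦ' (T.symm x) t))
    (H := fun x => hiddenEnergy p q lamStar muStar (T.symm x))
    ((continuous_hiddenEnergy p q lamStar muStar).comp T.symm.continuous).measurable
    (fun x t => by
      rw [T.symm_apply_apply, hiddenEnergy_eq_of_hasDerivAt hp hq hKKT1 hKKT2
        (hΦ' (T.symm x)) t 0, hΦ0])
    (fun c => (T.symm.isCompact_preimage.2
      (isCompact_hiddenEnergy_le hp01 hq01 lamStar muStar c)).measure_lt_top)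
  have hdim : Module.finrank ℝ (((Fin N → ℝ) × ℝ) × ((Fin M → ℝ) × ℝ))
      = Module.finrank ℝ ((Fin N → ℝ) × (Fin M → ℝ) × ℝ × ℝ) := by
    simp
    ring
  refine measure_mono_null ?_ (addHaar_image_eq_zero_of_differentiable_of_finrank_eq hdim
    (volume.prod volume) volume differentiable_separatedCoord_symm hrec)
  rintro x ⟨U, hU, hxU, t₀, ht₀⟩
  refine ⟨T x, fun h => ?_, T.symm_apply_apply x⟩
  have hfreq := h (T '' U) ((T.isOpen_image.2 hU).mem_nhds (mem_image_of_mem T hxU))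
  obtain ⟨n, ⟨y, hyU, hy⟩, hn⟩ :=
    (hfreq.and_eventually (tendsto_natCast_atTop_atTop.eventually_gt_atTop t₀)).exists
  rw [T.symm_apply_apply, T.injective.eq_iff] at hy
  exact ht₀ n hn (hy ▸ hyU)
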